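/- arXiv:2009.09418 — 2 statements merged into one kernel-verified Lean document; each statement's English description precedes it below -/
import Mathlib

section
/- Let n ∈ ℕ and define M_N(n) = E[ (G_{1,N}/(G_{1,N} + N − 1))^n ]. Then: (1) if β > 1, lim_{N→∞} M_N(n) = 1; (2) if β = 1, lim_{N→∞} M_N(n) = ∫_0^1 exp( − x^{1/n} / (κ(1 − x^{1/n})) ) dx; (3) if β < 1, M_N(n) ∼ n! κ^{nβ} N^{−n(1−β)} as N → ∞, i.e. the ratio of the two sides tends to 1. -/
open MeasureTheory Filter

lemma aux_ceil_Ioc {B : ℝ} (hB : 0 < B) (k : ℕ) {t : ℝ}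
    (ht : t ∈ Set.Ioc ((k:ℝ) / B) (((k:ℝ)+1) / B)) : ⌈t * B⌉₊ = k + 1 := by
  rw [Nat.ceil_eq_iff (by omega)]
  obtain ⟨h1, h2⟩ := ht
  rw [div_lt_iff₀ hB] at h1
  rw [le_div_iff₀ hB] at h2
  constructor
  · simpa using h1
  · push_cast; exact h2

lemma aux_union {B : ℝ} (hB : 0 < B) :
    (⋃ k : ℕ, Set.Ioc ((k:ℝ) / B) (((k:ℝ)+1) / B)) = Set.Ioi 0 := by
  ext t
  simp only [Set.mem_iUnion, Set.mem_Ioi]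
  constructor
  · rintro ⟨k, h1, h2⟩
    exact lt_of_le_of_lt (by positivity) h1
  · intro ht
    have h0 : 0 < t * B := by positivity
    have h1 : 0 < ⌈t * B⌉₊ := Nat.ceil_pos.2 h0
    obtain ⟨k, hk⟩ := Nat.exists_eq_succ_of_ne_zero h1.ne'
    have := (Nat.ceil_eq_iff (by omega)).1 hk
    refine ⟨k, ?_, ?_⟩
    · rw [div_lt_iff₀ hB]; simpa using this.1
    · rw [le_div_iff₀ hB]; simpa using this.2

lemma aux_exp_int (a b : ℝ) (hab : a ≤ b) :
    ∫ t in Set.Ioc a b, Real.exp (-t) = Real.exp (-a) - Real.exp (-b) := by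
  rw [← intervalIntegral.integral_of_le hab]
  rw [intervalIntegral.integral_eq_sub_of_hasDerivAt (f := fun t => - Real.exp (-t))]
  · ring
  · intro x _
    have := ((hasDerivAt_neg x).exp).neg
    refine this.congr_deriv ?_
    ring
  · exact (by fun_prop : Continuous fun t : ℝ => Real.exp (-t)).intervalIntegrable _ _

lemma aux_meas (B : ℝ) (h : ℕ → ℝ) :
    Measurable (fun t : ℝ => Real.exp (-t) * h ⌈t * B⌉₊) := by
  have h1 : Measurable (fun t : ℝ => ⌈t * B⌉₊) := Measurable.nat_ceil (by fun_prop)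
  have h2 : Measurable (fun t : ℝ => h ⌈t * B⌉₊) := (measurable_from_nat).comp h1
  exact (by fun_prop : Measurable fun t : ℝ => Real.exp (-t)).mul h2

lemma aux_sum {B : ℝ} (hB : 0 < B) (h : ℕ → ℝ) (h0 : ∀ k, |h k| ≤ 1) :
    ∑' k : ℕ, (Real.exp (-(1/B))) ^ k * (1 - Real.exp (-(1/B))) * h (k+1)
      = ∫ t in Set.Ioi (0:ℝ), Real.exp (-t) * h ⌈t * B⌉₊ := by
  have hint : IntegrableOn (fun t : ℝ => Real.exp (-t) * h ⌈t * B⌉₊) (Set.Ioi 0) := by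
    refine Integrable.mono' (integrableOn_exp_neg_Ioi 0) (aux_meas B h).aestronglyMeasurable ?_
    filter_upwards with t
    rw [Real.norm_eq_abs, abs_mul, abs_of_pos (Real.exp_pos _)]
    exact mul_le_of_le_one_right (Real.exp_pos _).le (h0 _)
  have hdis : Pairwise (Function.onFun Disjoint
      (fun k : ℕ => Set.Ioc ((k:ℝ) / B) (((k:ℝ)+1) / B))) := by
    intro i j hij
    rw [Function.onFun, Set.disjoint_left]
    intro t h1 h2
    have := aux_ceil_Ioc hB i h1
    have := aux_ceil_Ioc hB j h2
    omega
  have := hasSum_integral_iUnion (μ := volume) (fun k : ℕ => measurableSet_Ioc) hdis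
    (by rw [aux_union hB]; exact hint)
  rw [aux_union hB] at this
  rw [← this.tsum_eq]
  congr 1
  ext k
  rw [setIntegral_congr_fun (g := fun t => Real.exp (-t) * h (k+1)) measurableSet_Ioc
    (fun t ht => by simp only [aux_ceil_Ioc hB k ht])]
  rw [integral_mul_const, aux_exp_int _ _ (by gcongr; linarith)]
  congr 1
  rw [← Real.exp_nat_mul, mul_sub, mul_one, ← Real.exp_add]
  congr 2
  · ring_nf
  · ring_nf

lemma aux_a {B : ℕ → ℝ} (hB : Tendsto B atTop atTop) {t : ℝ} (ht : 0 < t) :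
    Tendsto (fun N => (⌈t * B N⌉₊ : ℝ) / B N) atTop (nhds t) :=
  (tendsto_nat_ceil_mul_div_atTop ht.le).comp hB

lemma aux_X01 (k N : ℕ) : 0 ≤ ((k:ℝ) / ((k:ℝ) + (N:ℝ) - 1)) ∨ k = 0 := by
  rcases Nat.eq_zero_or_pos k with h | h
  · right; exact h
  · left
    have : (1:ℝ) ≤ k := by exact_mod_cast h
    have : (0:ℝ) ≤ N := by positivity
    exact div_nonneg (by linarith) (by linarith)

lemma aux_Xabs (k N n : ℕ) (hN : 1 ≤ N) : |((k:ℝ) / ((k:ℝ) + (N:ℝ) - 1)) ^ n| ≤ 1 := by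
  have h1 : (1:ℝ) ≤ N := by exact_mod_cast hN
  have h2 : (0:ℝ) ≤ k := by positivity
  rw [abs_pow]
  apply pow_le_one₀ (abs_nonneg _)
  rw [abs_of_nonneg (div_nonneg h2 (by linarith))]
  exact div_le_one_of_le₀ (by linarith) (by linarith)

lemma aux_lim12 {B : ℕ → ℝ} (hB : Tendsto B atTop atTop) {ρ : ℝ} (hρ : 0 ≤ ρ)
    (hr : Tendsto (fun N : ℕ => (N:ℝ) / B N) atTop (nhds ρ)) (n : ℕ) :
    Tendsto (fun N : ℕ => ∫ t in Set.Ioi (0:ℝ), Real.exp (-t) *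
      ((⌈t * B N⌉₊:ℝ) / ((⌈t * B N⌉₊:ℝ) + (N:ℝ) - 1)) ^ n) atTop
      (nhds (∫ t in Set.Ioi (0:ℝ), Real.exp (-t) * (t / (t + ρ)) ^ n)) := by
  apply tendsto_integral_filter_of_dominated_convergence (fun t => Real.exp (-t))
  · filter_upwards with N
    exact (aux_meas (B N) (fun k => ((k:ℝ) / ((k:ℝ) + (N:ℝ) - 1)) ^ n)).aestronglyMeasurable
  · filter_upwards [eventually_ge_atTop 1] with N hN
    filter_upwards with t
    rw [Real.norm_eq_abs, abs_mul, abs_of_pos (Real.exp_pos _)]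
    exact mul_le_of_le_one_right (Real.exp_pos _).le (aux_Xabs _ _ _ hN)
  · exact integrableOn_exp_neg_Ioi 0
  · filter_upwards [ae_restrict_mem measurableSet_Ioi] with t ht
    have ht' : 0 < t := ht
    refine Tendsto.const_mul _ (Tendsto.pow ?_ n)
    have ha := aux_a hB ht'
    have hb : Tendsto (fun N => (B N)⁻¹) atTop (nhds 0) := tendsto_inv_atTop_zero.comp hB
    have := ha.div ((ha.add hr).sub hb)
      (by rw [sub_zero]; exact (add_pos_of_pos_of_nonneg ht' hρ).ne')
    rw [sub_zero] at this
    refine this.congr' ?_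
    filter_upwards [hB.eventually_gt_atTop 0] with N hN
    simp only [Pi.div_apply]
    rw [← add_div, ← one_div, ← sub_div, div_div_div_cancel_right₀ hN.ne']

lemma aux_lim3 {B : ℕ → ℝ} (hB : Tendsto B atTop atTop)
    (hr : Tendsto (fun N : ℕ => (N:ℝ) / B N) atTop atTop) (n : ℕ) :
    Tendsto (fun N : ℕ => ((N:ℝ) / B N) ^ n * ∫ t in Set.Ioi (0:ℝ), Real.exp (-t) *
      ((⌈t * B N⌉₊:ℝ) / ((⌈t * B N⌉₊:ℝ) + (N:ℝ) - 1)) ^ n) atTop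
      (nhds (n.factorial : ℝ)) := by
  have hfac : ∫ t in Set.Ioi (0:ℝ), Real.exp (-t) * t ^ n = (n.factorial : ℝ) := by
    rw [← Real.Gamma_nat_eq_factorial, Real.Gamma_eq_integral (by positivity)]
    simp
  have hgi : IntegrableOn (fun t : ℝ => Real.exp (-t) * t ^ n) (Set.Ioi 0) := by
    have := Real.GammaIntegral_convergent (s := (n:ℝ) + 1) (by positivity)
    simpa using this
  rw [← hfac]
  simp_rw [← integral_const_mul]
  apply tendsto_integral_filter_of_dominated_convergence
    (fun t => 2 ^ (n - 1) * (Real.exp (-t) * t ^ n + Real.exp (-t)))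
  · filter_upwards with N
    exact ((aux_meas (B N) (fun k => ((k:ℝ) / ((k:ℝ) + (N:ℝ) - 1)) ^ n)).const_mul
      _).aestronglyMeasurable
  · filter_upwards [eventually_ge_atTop 1, hB.eventually_ge_atTop 1] with N hN hBN
    filter_upwards [ae_restrict_mem measurableSet_Ioi] with t ht
    have ht' : 0 < t := ht
    have hB0 : 0 < B N := by linarith
    have h1 : (1:ℝ) ≤ N := by exact_mod_cast hN
    have hk : (1:ℝ) ≤ (⌈t * B N⌉₊ : ℝ) := by
      exact_mod_cast Nat.ceil_pos.2 (by positivity : 0 < t * B N)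
    have hk2 := (Nat.ceil_lt_add_one (by positivity : 0 ≤ t * B N)).le
    set k : ℝ := (⌈t * B N⌉₊ : ℝ) with hkdef
    have hx : 0 ≤ k / (k + N - 1) := div_nonneg (by linarith) (by linarith)
    rw [Real.norm_eq_abs, abs_of_nonneg (by positivity)]
    have h3 : (N / B N) * (k / (k + N - 1)) ≤ t + 1 := by
      rw [div_mul_div_comm, div_le_iff₀ (mul_pos hB0 (by linarith))]
      have e1 : k ≤ (t + 1) * B N := by nlinarith
      have e2 : (0:ℝ) ≤ (t + 1) * B N := by positivity
      nlinarith
    calc _ = Real.exp (-t) * ((N / B N) * (k / (k + N - 1))) ^ n := by rw [mul_pow]; ring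
      _ ≤ Real.exp (-t) * (t + 1) ^ n := by gcongr
      _ ≤ Real.exp (-t) * (2 ^ (n - 1) * (t ^ n + 1 ^ n)) := by
        gcongr
        exact add_pow_le ht'.le zero_le_one n
      _ = _ := by rw [one_pow]; ring
  · exact (hgi.add (integrableOn_exp_neg_Ioi 0)).const_mul _
  · filter_upwards [ae_restrict_mem measurableSet_Ioi] with t ht
    have ht' : 0 < t := ht
    have ha := aux_a hB ht'
    have hb : Tendsto (fun N : ℕ => ((N:ℝ) / B N)⁻¹) atTop (nhds 0) :=
      tendsto_inv_atTop_zero.comp hr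
    have hN : Tendsto (fun N : ℕ => ((N:ℝ))⁻¹) atTop (nhds 0) := tendsto_inv_atTop_nhds_zero_nat
    have := ha.div (((ha.mul hb).add_const 1).sub hN) (by simp)
    have := (this.pow n).const_mul (Real.exp (-t))
    simp only [mul_zero, zero_add, sub_zero, div_one] at this
    refine this.congr' ?_
    filter_upwards [hB.eventually_gt_atTop 0, eventually_ge_atTop 1] with N hN hN1
    have h1 : (1:ℝ) ≤ N := by exact_mod_cast hN1
    have hk : (1:ℝ) ≤ (⌈t * B N⌉₊ : ℝ) := by
      exact_mod_cast Nat.ceil_pos.2 (by positivity : 0 < t * B N)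
    simp only [Pi.div_apply]
    rw [mul_left_comm, ← mul_pow]
    congr 2
    set k : ℝ := (⌈t * B N⌉₊ : ℝ) with hkdef
    have e1 : k / B N * ((N:ℝ) / B N)⁻¹ + 1 - (N:ℝ)⁻¹ = (k + N - 1) / N := by
      field_simp
    rw [e1]
    have : k + N - 1 ≠ 0 := by linarith
    field_simp

lemma aux_change {κ : ℝ} (hκ : 0 < κ) {n : ℕ} (hn : 1 ≤ n) :
    ∫ t in Set.Ioi (0:ℝ), Real.exp (-t) * (t / (t + κ⁻¹)) ^ n =
    ∫ x in (0:ℝ)..1, Real.exp (-(x ^ ((n : ℝ)⁻¹) / (κ * (1 - x ^ ((n : ℝ)⁻¹))))) := by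
  set c : ℝ := κ⁻¹ with hc
  have hc0 : 0 < c := inv_pos.2 hκ
  have hn0 : n ≠ 0 := by omega
  set φ : ℝ → ℝ := fun t => (t / (t + c)) ^ n with hφ
  set φ' : ℝ → ℝ := fun t => n * (t / (t + c)) ^ (n-1) * (c / (t + c)^2) with hφ'
  have hd : ∀ t : ℝ, 0 ≤ t → HasDerivAt φ (φ' t) t := by
    intro t ht
    have hne : t + c ≠ 0 := by positivity
    have := ((hasDerivAt_id t).div ((hasDerivAt_id t).add_const c) hne).pow n
    refine this.congr_deriv ?_
    simp only [hφ', id]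
    congr 1
    ring
  have hφ01 : ∀ t : ℝ, 0 ≤ t → 0 ≤ t / (t + c) ∧ t / (t + c) < 1 := by
    intro t ht
    refine ⟨by positivity, ?_⟩
    rw [div_lt_one (by positivity)]; linarith
  have hroot : ∀ t : ℝ, 0 ≤ t → (φ t) ^ ((n:ℝ)⁻¹) = t / (t + c) := fun t ht =>
    Real.pow_rpow_inv_natCast (hφ01 t ht).1 hn0
  have hinv : ∀ t : ℝ, 0 ≤ t →
      (φ t) ^ ((n : ℝ)⁻¹) / (κ * (1 - (φ t) ^ ((n : ℝ)⁻¹))) = t := by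
    intro t ht
    rw [hroot t ht]
    have hne : t + c ≠ 0 := by positivity
    have : 1 - t / (t + c) = c / (t + c) := by field_simp; ring
    rw [this, hc]
    have hne' : t + κ⁻¹ ≠ 0 := by positivity
    field_simp
  have himg : φ '' Set.Ioi 0 = Set.Ioo 0 1 := by
    ext x
    constructor
    · rintro ⟨t, ht, rfl⟩
      have ht' : 0 < t := ht
      exact ⟨by positivity, pow_lt_one₀ (hφ01 t ht'.le).1 (hφ01 t ht'.le).2 hn0⟩
    · rintro ⟨h0, h1⟩
      have hy0 : 0 < x ^ ((n:ℝ)⁻¹) := by positivity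
      have hy1 : x ^ ((n:ℝ)⁻¹) < 1 := Real.rpow_lt_one h0.le h1 (by positivity)
      have hyn : (x ^ ((n:ℝ)⁻¹)) ^ n = x := Real.rpow_inv_natCast_pow h0.le hn0
      set y := x ^ ((n:ℝ)⁻¹)
      have hy2 : 0 < 1 - y := by linarith
      refine ⟨c * y / (1 - y), by simp only [Set.mem_Ioi]; positivity, ?_⟩
      rw [← hyn]
      simp only [hφ]
      congr 1
      have : c * y / (1 - y) + c = c / (1 - y) := by field_simp; ring
      rw [this]
      field_simp
  have hinj : Set.InjOn φ (Set.Ioi 0) := by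
    intro s hs t ht hst
    rw [← hinv s (le_of_lt hs), ← hinv t (le_of_lt ht), hst]
  rw [intervalIntegral.integral_of_le zero_le_one, integral_Ioc_eq_integral_Ioo, ← himg,
    integral_image_eq_integral_abs_deriv_smul measurableSet_Ioi
      (fun t ht => (hd t (le_of_lt ht)).hasDerivWithinAt) hinj]
  have hφ'm : Measurable φ' := by fun_prop
  have hφm : Measurable φ := by fun_prop
  have hφ'0 : ∀ t : ℝ, 0 ≤ t → 0 ≤ φ' t := by intro t ht; positivity
  have hφ'b : ∀ t : ℝ, 0 ≤ t → φ' t ≤ n * c⁻¹ := by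
    intro t ht
    have h1 : (t / (t+c)) ^ (n-1) ≤ 1 := pow_le_one₀ (hφ01 t ht).1 (hφ01 t ht).2.le
    have h2 : c / (t+c)^2 ≤ c⁻¹ := by
      rw [div_le_iff₀ (by positivity)]
      field_simp
      nlinarith
    calc φ' t ≤ n * 1 * c⁻¹ := by simp only [hφ']; gcongr
      _ = _ := by ring
  have hI : IntegrableOn (fun t => Real.exp (-t) * φ t) (Set.Ioi 0) := by
    refine Integrable.mono' (integrableOn_exp_neg_Ioi 0) (by fun_prop) ?_
    filter_upwards [ae_restrict_mem measurableSet_Ioi] with t ht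
    have ht' : 0 < t := ht
    rw [Real.norm_eq_abs, abs_mul, abs_of_pos (Real.exp_pos _)]
    refine mul_le_of_le_one_right (Real.exp_pos _).le ?_
    rw [abs_of_nonneg (by positivity)]
    exact pow_le_one₀ (hφ01 t ht'.le).1 (hφ01 t ht'.le).2.le
  have hI' : IntegrableOn (fun t => Real.exp (-t) * φ' t) (Set.Ioi 0) := by
    refine Integrable.mono' ((integrableOn_exp_neg_Ioi 0).mul_const (n * c⁻¹)) (by fun_prop) ?_
    filter_upwards [ae_restrict_mem measurableSet_Ioi] with t ht
    have ht' : 0 < t := ht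
    rw [Real.norm_eq_abs, abs_mul, abs_of_pos (Real.exp_pos _), abs_of_nonneg (hφ'0 t ht'.le)]
    gcongr
    exact hφ'b t ht'.le
  have hder : ∀ t : ℝ, 0 ≤ t → HasDerivAt (fun t => Real.exp (-t) * φ t)
      (Real.exp (-t) * φ' t - Real.exp (-t) * φ t) t := by
    intro t ht
    have := ((hasDerivAt_neg t).exp).mul (hd t ht)
    refine this.congr_deriv ?_
    ring
  have key := integral_Ioi_of_hasDerivAt_of_tendsto (a := 0) (m := 0)
    (hder 0 le_rfl).continuousAt.continuousWithinAt (fun t ht => hder t (le_of_lt ht))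
    (hI'.sub hI) (by
      refine squeeze_zero' ?_ ?_ (Real.tendsto_exp_neg_atTop_nhds_zero)
      · filter_upwards [eventually_ge_atTop 0] with t ht
        positivity
      · filter_upwards [eventually_ge_atTop 0] with t ht
        exact mul_le_of_le_one_right (Real.exp_pos _).le
          (pow_le_one₀ (hφ01 t ht).1 (hφ01 t ht).2.le))
  rw [integral_sub hI' hI] at key
  have hφ00 : φ 0 = 0 := by simp [hφ, hn0]
  rw [hφ00] at key
  have : ∫ t in Set.Ioi (0:ℝ), Real.exp (-t) * φ t = ∫ t in Set.Ioi (0:ℝ), Real.exp (-t) * φ' t := by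
    linarith
  rw [this]
  refine setIntegral_congr_fun measurableSet_Ioi (fun t ht => ?_)
  have ht' : 0 < t := ht
  simp only [smul_eq_mul]
  rw [hinv t ht'.le, abs_of_nonneg (hφ'0 t ht'.le), mul_comm]

/-- Fix `κ, β > 0` and let `G_{1,N}` be geometric on `{1,2,…}` with success
parameter `(κN)^{−β}` (for `N` with `(κN)^β > 1`), and
`M_N(n) = E[(G_{1,N}/(G_{1,N}+N−1))^n]`.  Then for `n ≥ 1`:
(1) if `β > 1` then `M_N(n) → 1`;
(2) if `β = 1` then `M_N(n) → ∫₀¹ exp(−x^{1/n}/(κ(1−x^{1/n}))) dx`;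
(3) if `β < 1` then `M_N(n) ∼ n! κ^{nβ} N^{−n(1−β)}`. -/
theorem stmt_6 (κ β : ℝ) (hκ : 0 < κ) (hβ : 0 < β) (n : ℕ) (hn : 1 ≤ n)
    (M : ℕ → ℝ)
    (hM : ∀ N : ℕ, 1 < (κ * (N : ℝ)) ^ β →
      M N = ∑' k : ℕ,
        (1 - ((κ * (N : ℝ)) ^ β)⁻¹) ^ k * ((κ * (N : ℝ)) ^ β)⁻¹ *
          (((k : ℝ) + 1) / (((k : ℝ) + 1) + (N : ℝ) - 1)) ^ n) :
    (1 < β → Tendsto M atTop (nhds 1)) ∧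
    (β = 1 → Tendsto M atTop (nhds
      (∫ x in (0:ℝ)..1, Real.exp (-(x ^ ((n : ℝ)⁻¹) / (κ * (1 - x ^ ((n : ℝ)⁻¹)))))))) ∧
    (β < 1 → Tendsto
      (fun N : ℕ => M N /
        ((n.factorial : ℝ) * κ ^ ((n : ℝ) * β) * (N : ℝ) ^ (-((n : ℝ) * (1 - β)))))
      atTop (nhds 1)) := by
  set A : ℕ → ℝ := fun N => (κ * (N:ℝ)) ^ β with hA
  have hAt : Tendsto A atTop atTop :=
    (tendsto_rpow_atTop hβ).comp (tendsto_natCast_atTop_atTop.const_mul_atTop hκ)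
  set lam : ℕ → ℝ := fun N => - Real.log (1 - (A N)⁻¹) with hlam
  have hlA : Tendsto (fun N => lam N * A N) atTop (nhds 1) := by
    have := ((Real.tendsto_mul_log_one_add_div_atTop (-1)).comp hAt).neg
    rw [neg_neg] at this
    refine this.congr (fun N => ?_)
    simp only [Function.comp, hlam]
    rw [show 1 + -1 / A N = 1 - (A N)⁻¹ by rw [neg_div, one_div]; ring]
    ring
  have hlpos : ∀ N, 1 < A N → 0 < lam N := by
    intro N h
    have h1 : (A N)⁻¹ < 1 := inv_lt_one_of_one_lt₀ h
    have h2 : 0 < (A N)⁻¹ := by positivity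
    have := Real.log_neg (x := 1 - (A N)⁻¹) (by linarith) (by linarith)
    simp only [hlam]; linarith
  set B : ℕ → ℝ := fun N => (lam N)⁻¹ with hBdef
  have hl0 : Tendsto lam atTop (nhds 0) := by
    have := hlA.mul (tendsto_inv_atTop_zero.comp hAt)
    rw [mul_zero] at this
    refine this.congr' ?_
    filter_upwards [hAt.eventually_gt_atTop 1] with N hN
    have : A N ≠ 0 := by linarith
    simp only [Function.comp]
    field_simp
  have hB : Tendsto B atTop atTop := by
    apply Tendsto.inv_tendsto_nhdsGT_zero
    rw [tendsto_nhdsWithin_iff]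
    refine ⟨hl0, ?_⟩
    filter_upwards [hAt.eventually_gt_atTop 1] with N hN using hlpos N hN
  have hMint : ∀ᶠ N : ℕ in atTop, M N = ∫ t in Set.Ioi (0:ℝ), Real.exp (-t) *
      ((⌈t * B N⌉₊:ℝ) / ((⌈t * B N⌉₊:ℝ) + (N:ℝ) - 1)) ^ n := by
    filter_upwards [hAt.eventually_gt_atTop 1, eventually_ge_atTop 1] with N hN hN1
    have hBpos : 0 < B N := inv_pos.2 (hlpos N hN)
    have h1 : (A N)⁻¹ < 1 := inv_lt_one_of_one_lt₀ hN
    have he : Real.exp (-(1 / B N)) = 1 - (A N)⁻¹ := by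
      simp only [hBdef, hlam, one_div, inv_inv, neg_neg]
      exact Real.exp_log (by linarith)
    have := aux_sum hBpos (fun k => ((k:ℝ) / ((k:ℝ) + (N:ℝ) - 1)) ^ n)
      (fun k => aux_Xabs k N n hN1)
    rw [← this, hM N hN, he]
    simp only [sub_sub_cancel, Nat.cast_add, Nat.cast_one, hA]
  have hNB : ∀ᶠ N : ℕ in atTop, (N:ℝ) / B N = (lam N * A N) * (κ ^ (-β) * (N:ℝ) ^ (1 - β)) := by
    filter_upwards [eventually_ge_atTop 1] with N hN1
    have hNp : (0:ℝ) < N := by exact_mod_cast hN1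
    simp only [hBdef, hA, div_inv_eq_mul]
    rw [Real.mul_rpow hκ.le hNp.le, Real.rpow_neg hκ.le, Real.rpow_sub hNp, Real.rpow_one]
    field_simp
  refine ⟨fun h => ?_, fun h => ?_, fun h => ?_⟩
  · have hr : Tendsto (fun N : ℕ => (N:ℝ) / B N) atTop (nhds 0) := by
      have h1 : Tendsto (fun N : ℕ => (N:ℝ) ^ (1 - β)) atTop (nhds 0) := by
        have := (tendsto_rpow_neg_atTop (y := β - 1) (by linarith)).comp
          (tendsto_natCast_atTop_atTop (R := ℝ))
        simpa [Function.comp_def] using this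
      have := hlA.mul (h1.const_mul (κ ^ (-β)))
      simp only [mul_zero] at this
      exact this.congr' (hNB.mono fun N hN => hN.symm)
    have := aux_lim12 hB le_rfl hr n
    have e : ∫ t in Set.Ioi (0:ℝ), Real.exp (-t) * (t / (t + 0)) ^ n = 1 := by
      rw [← integral_exp_neg_Ioi_zero]
      refine setIntegral_congr_fun measurableSet_Ioi (fun t ht => ?_)
      have ht' : t ≠ 0 := ne_of_gt ht
      simp [ht']
    rw [e] at this
    exact this.congr' (hMint.mono fun N hN => hN.symm)
  · have hr : Tendsto (fun N : ℕ => (N:ℝ) / B N) atTop (nhds κ⁻¹) := by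
      have := hlA.mul_const (κ⁻¹)
      rw [one_mul] at this
      refine this.congr' (hNB.mono fun N hN => ?_)
      beta_reduce
      rw [hN, h]
      simp [Real.rpow_neg_one]
    have := aux_lim12 hB (inv_pos.2 hκ).le hr n
    rw [aux_change hκ hn] at this
    exact this.congr' (hMint.mono fun N hN => hN.symm)
  · have hr : Tendsto (fun N : ℕ => (N:ℝ) / B N) atTop atTop := by
      have h1 : Tendsto (fun N : ℕ => (N:ℝ) ^ (1 - β)) atTop atTop :=
        (tendsto_rpow_atTop (by linarith)).comp tendsto_natCast_atTop_atTop
      have := hlA.pos_mul_atTop one_pos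
        (h1.const_mul_atTop (by positivity : 0 < κ ^ (-β)))
      exact this.congr' (hNB.mono fun N hN => hN.symm)
    have h3 := aux_lim3 hB hr n
    have h4 := (h3.mul ((hlA.pow n).inv₀ (by simp))).mul_const ((n.factorial:ℝ)⁻¹)
    have hf : (n.factorial : ℝ) ≠ 0 := by positivity
    have e : (n.factorial : ℝ) * (1 ^ n)⁻¹ * (n.factorial : ℝ)⁻¹ = 1 := by
      rw [one_pow]; field_simp
    rw [e] at h4
    refine h4.congr' ?_
    filter_upwards [hMint, hNB, hAt.eventually_gt_atTop 1, eventually_ge_atTop 1]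
      with N h5 h6 h7 h8
    have hNp : (0:ℝ) < N := by exact_mod_cast h8
    have hl := hlpos N h7
    rw [← h5, h6]
    have hA0 : 0 < A N := by linarith
    have e1 : κ ^ ((n:ℝ) * β) = (κ ^ β) ^ n := by
      rw [mul_comm, Real.rpow_mul hκ.le, Real.rpow_natCast]
    have e2 : (N:ℝ) ^ (-((n:ℝ) * (1 - β))) = (((N:ℝ) ^ (1 - β)) ^ n)⁻¹ := by
      rw [Real.rpow_neg hNp.le, mul_comm, Real.rpow_mul hNp.le, Real.rpow_natCast]
    rw [e1, e2, Real.rpow_neg hκ.le]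
    have p1 : 0 < κ ^ β := by positivity
    have p2 : 0 < (N:ℝ) ^ (1 - β) := by positivity
    have p3 : 0 < lam N * A N := by positivity
    generalize κ ^ β = u at *
    generalize (N:ℝ) ^ (1 - β) = v at *
    generalize lam N * A N = w at *
    rw [mul_pow, mul_pow, inv_pow]
    field_simp
end

section
/- An integrable function h : (0,1) → (0,∞) can be expressed as h(y) = ∫_0^∞ (1/κ) (y/(1−y))² exp( − y/(κ(1−y)) ) η(dκ) for all y ∈ (0,1), for some measure η on (0,∞), if and only if there exists a completely monotone function g : (0,∞) → (0,∞) such that h(y) = (y/(1−y))² · g( y/(1−y) ) for all y ∈ (0,1) and ∫_0^∞ g(v) (1 ∧ v²) dv < ∞. -/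
open MeasureTheory Filter

/-- A function `g` is completely monotone on `(0,∞)` if it is infinitely differentiable there
and `(−1)^n g^{(n)}(v) ≥ 0` for all `n ≥ 0` and all `v > 0`. -/
def CompletelyMonotoneOnPos (g : ℝ → ℝ) : Prop :=
  ContDiffOn ℝ (⊤ : ℕ∞) g (Set.Ioi 0) ∧
    ∀ n : ℕ, ∀ v ∈ Set.Ioi (0 : ℝ), 0 ≤ (-1 : ℝ) ^ n * iteratedDerivWithin n g (Set.Ioi 0) v

open Polynomial in
theorem bern_fall (j : ℕ) : ∀ n : ℕ, ∑ k ∈ Finset.range (n+1),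
    ((k.descFactorial j : ℝ) * (n.choose k : ℝ)) • ((X : ℝ[X]) ^ k * (1 - X) ^ (n - k)) =
      (n.descFactorial j : ℝ) • (X : ℝ[X]) ^ j := by
  induction j with
  | zero =>
    intro n
    have := add_pow (X : ℝ[X]) (1 - X) n
    simp only [add_sub_cancel, one_pow] at this
    simp only [Nat.descFactorial_zero, Nat.cast_one, one_mul, pow_zero, one_smul]
    refine Eq.trans ?_ this.symm
    refine Finset.sum_congr rfl fun k _ => ?_
    rw [Polynomial.smul_eq_C_mul]
    simp only [map_natCast]
    ring
  | succ j ih =>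
    intro n
    cases n with
    | zero => simp
    | succ n =>
      rw [Finset.sum_range_succ']
      simp only [Nat.zero_descFactorial_succ, Nat.cast_zero, zero_mul, zero_smul, add_zero]
      have e : ((n+1).descFactorial (j+1) : ℝ) • (X : ℝ[X]) ^ (j+1)
          = ((n+1 : ℝ) • X) * ((n.descFactorial j : ℝ) • (X : ℝ[X]) ^ j) := by
        rw [Nat.succ_descFactorial_succ, Polynomial.smul_eq_C_mul, Polynomial.smul_eq_C_mul,
          Polynomial.smul_eq_C_mul]
        push_cast
        simp only [C_mul]
        ring
      rw [e, ← ih n, Finset.mul_sum]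
      refine Finset.sum_congr rfl fun k _ => ?_
      have h2 : ((n+1 : ℝ)) * (n.choose k : ℝ) = ((n+1).choose (k+1) : ℝ) * (k+1) := by
        exact_mod_cast Nat.add_one_mul_choose_eq n k
      rw [Nat.succ_descFactorial_succ, Nat.add_sub_add_right, Polynomial.smul_eq_C_mul,
        Polynomial.smul_eq_C_mul, Polynomial.smul_eq_C_mul]
      have h3 : (((k+1) * k.descFactorial j : ℕ) : ℝ) * ((n+1).choose (k+1) : ℝ) =
        (n+1 : ℝ) * ((k.descFactorial j : ℝ) * (n.choose k : ℝ)) := by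
        push_cast
        linear_combination (-(k.descFactorial j : ℝ)) * h2
      rw [h3]
      simp only [C_mul]
      ring

theorem desc_lim (j : ℕ) : Tendsto (fun n : ℕ => (n.descFactorial j : ℝ) / (n:ℝ)^j) atTop (nhds 1) := by
  induction j with
  | zero => simp
  | succ j ih =>
    have h1 : Tendsto (fun n : ℕ => 1 - (j:ℝ) / (n:ℝ)) atTop (nhds (1 - 0)) :=
      tendsto_const_nhds.sub (tendsto_const_div_atTop_nhds_zero_nat _)
    have := h1.mul ih
    rw [sub_zero, one_mul] at this
    refine this.congr' ?_
    filter_upwards [eventually_ge_atTop (j+1)] with n hn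
    have : (n:ℝ) ≠ 0 := by
      have : 0 < n := by omega
      positivity
    rw [Nat.descFactorial_succ]
    push_cast [Nat.cast_sub (show j ≤ n by omega)]
    field_simp
    ring

theorem mom_lim (w : ℕ → ℕ → ℝ) (c : ℕ → ℝ)
    (hw : ∀ n j, ∑ k ∈ Finset.range (n+1), (k.descFactorial j : ℝ) * w n k = n.descFactorial j * c j)
    (i : ℕ) : ∀ j, Tendsto (fun n : ℕ => (∑ k ∈ Finset.range (n+1),
      (k:ℝ)^i * ((k.descFactorial j : ℝ) * w n k)) / (n:ℝ)^(i+j)) atTop (nhds (c (i+j))) := by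
  induction i with
  | zero =>
    intro j
    simp only [pow_zero, one_mul, zero_add, hw]
    have := (desc_lim j).mul_const (c j)
    rw [one_mul] at this
    refine this.congr fun n => ?_
    ring
  | succ i ih =>
    intro j
    have h1 := ih (j+1)
    have h2 : Tendsto (fun n : ℕ => (j:ℝ) / (n:ℝ)) atTop (nhds 0) :=
      (tendsto_const_div_atTop_nhds_zero_nat _)
    have := h1.add (h2.mul (ih j))
    rw [zero_mul, add_zero, show i + (j+1) = i+1+j by ring] at this
    refine this.congr' ?_
    filter_upwards [eventually_ge_atTop 1] with n hn
    have hn' : (n:ℝ) ≠ 0 := by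
      have : 0 < n := by omega
      positivity
    have e : ∑ k ∈ Finset.range (n+1), (k:ℝ)^(i+1) * ((k.descFactorial j : ℝ) * w n k)
       = ∑ k ∈ Finset.range (n+1), (k:ℝ)^i * ((k.descFactorial (j+1) : ℝ) * w n k)
        + j * ∑ k ∈ Finset.range (n+1), (k:ℝ)^i * ((k.descFactorial j : ℝ) * w n k) := by
      rw [Finset.mul_sum, ← Finset.sum_add_distrib]
      refine Finset.sum_congr rfl fun k _ => ?_
      have : ((k.descFactorial (j+1) : ℕ) : ℝ) = ((k:ℝ) - j) * k.descFactorial j := by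
        rw [Nat.descFactorial_succ]
        rcases le_or_gt j k with h | h
        · push_cast [Nat.cast_sub h]; ring
        · rw [Nat.descFactorial_of_lt h]; simp
      rw [this]
      ring
    rw [e, add_div]
    congr 1
    rw [show i + 1 + j = (i+j)+1 by ring, pow_succ]
    field_simp

open Polynomial in
theorem hausdorff (L : ℝ[X] →ₗ[ℝ] ℝ) (hpos : ∀ k j, 0 ≤ L (X ^ k * (1 - X) ^ j)) (h1 : L 1 = 1) :
    ∃ P : ProbabilityMeasure unitInterval, ∀ m : ℕ, ∫ x, (x:ℝ)^m ∂(P : Measure unitInterval) = L (X^m) := by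
  set w : ℕ → ℕ → ℝ := fun n k => (n.choose k : ℝ) * L (X ^ k * (1 - X) ^ (n-k)) with hwdef
  have hw0 : ∀ n k, 0 ≤ w n k := fun n k => mul_nonneg (by positivity) (hpos _ _)
  have hw : ∀ n j, ∑ k ∈ Finset.range (n+1), (k.descFactorial j : ℝ) * w n k
      = n.descFactorial j * L (X^j) := by
    intro n j
    have := congrArg L (bern_fall j n)
    simp only [map_sum, map_smul, smul_eq_mul] at this
    rw [← this]
    exact Finset.sum_congr rfl fun k _ => by simp only [hwdef]; ring
  have hsum : ∀ n, ∑ k ∈ Finset.range (n+1), w n k = 1 := by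
    intro n
    have := hw n 0
    simpa [h1] using this
  let pt : ℕ → ℕ → unitInterval := fun n k => Set.projIcc 0 1 zero_le_one ((k:ℝ)/n)
  let Q : ℕ → Measure unitInterval := fun n =>
    ∑ k ∈ Finset.range (n+1), ENNReal.ofReal (w n k) • Measure.dirac (pt n k)
  have hQ : ∀ n, IsProbabilityMeasure (Q n) := by
    intro n
    constructor
    simp only [Q, Measure.coe_finsetSum, Finset.sum_apply, Measure.smul_apply, measure_univ,
      smul_eq_mul, mul_one]
    rw [← ENNReal.ofReal_sum_of_nonneg (fun k _ => hw0 n k), hsum, ENNReal.ofReal_one]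
  have hQi : ∀ n (f : unitInterval → ℝ), ∫ x, f x ∂(Q n) = ∑ k ∈ Finset.range (n+1), w n k * f (pt n k) := by
    intro n f
    simp only [Q]
    rw [integral_finsetSum_measure]
    · refine Finset.sum_congr rfl fun k _ => ?_
      rw [integral_smul_measure, integral_dirac, ENNReal.toReal_ofReal (hw0 n k), smul_eq_mul]
    · intro k _
      exact (integrable_dirac (by simp [enorm_lt_top])).smul_measure ENNReal.ofReal_ne_top
  let P : ℕ → ProbabilityMeasure unitInterval := fun n => ⟨Q n, hQ n⟩
  let U : Ultrafilter (ProbabilityMeasure unitInterval) := (hyperfilter ℕ).map P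
  have hU : Tendsto P (hyperfilter ℕ : Filter ℕ) (nhds U.lim) := U.le_nhds_lim
  refine ⟨U.lim, fun m => ?_⟩
  rw [ProbabilityMeasure.tendsto_iff_forall_integral_tendsto] at hU
  let f : BoundedContinuousFunction unitInterval ℝ :=
    BoundedContinuousFunction.mkOfCompact ⟨fun x => (x:ℝ)^m, by fun_prop⟩
  have t1 := hU f
  have t2 : Tendsto (fun n => ∫ x, f x ∂(P n : Measure unitInterval)) atTop (nhds (L (X^m))) := by
    have := mom_lim w (fun j => L (X^j)) hw m 0
    simp only [add_zero, Nat.descFactorial_zero, Nat.cast_one, one_mul] at this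
    refine this.congr' ?_
    filter_upwards [eventually_ge_atTop 1] with n hn
    have hn' : (0:ℝ) < n := by
      have : 0 < n := by omega
      positivity
    change _ = ∫ x, f x ∂(Q n)
    rw [hQi, Finset.sum_div]
    refine Finset.sum_congr rfl fun k hk => ?_
    have hk' : (k:ℝ) ≤ n := by
      have := Finset.mem_range.1 hk
      exact_mod_cast (by omega : k ≤ n)
    have : ((pt n k : unitInterval) : ℝ) = k / n := by
      simp only [pt]
      rw [Set.projIcc_of_mem zero_le_one (x := (k:ℝ)/n) ⟨by positivity, (div_le_one hn').2 hk'⟩]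
    change _ = w n k * ((pt n k : unitInterval) : ℝ)^m
    rw [this, div_pow]
    ring
  exact tendsto_nhds_unique t1 (t2.mono_left Nat.hyperfilter_le_atTop)

theorem meas_uniq (μ ν : Measure unitInterval) [IsFiniteMeasure μ] [IsFiniteMeasure ν]
    (h : ∀ m : ℕ, ∫ x, (x:ℝ)^m ∂μ = ∫ x, (x:ℝ)^m ∂ν) : μ = ν := by
  have hi : ∀ (ρ : Measure unitInterval) [IsFiniteMeasure ρ] (f : C(unitInterval, ℝ)), Integrable f ρ := by
    intro ρ _ f
    exact (BoundedContinuousFunction.mkOfCompact f).integrable ρ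
  have hc : ∀ (ρ : Measure unitInterval) [IsFiniteMeasure ρ],
      Continuous (fun f : C(unitInterval, ℝ) => ∫ x, f x ∂ρ) := by
    intro ρ _
    refine (LipschitzWith.of_dist_le_mul (K := ⟨ρ.real Set.univ, measureReal_nonneg⟩)
      fun f g => ?_).continuous
    rw [dist_eq_norm, dist_eq_norm, ← integral_sub (hi ρ f) (hi ρ g)]
    have := norm_integral_le_of_norm_le_const (μ := ρ) (f := fun x => f x - g x) (C := ‖f - g‖)
      (Eventually.of_forall fun x => (f - g).norm_coe_le_norm x)
    rw [mul_comm]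
    exact this
  have hp : ∀ p : Polynomial ℝ, ∫ x : unitInterval, p.eval (x:ℝ) ∂μ = ∫ x : unitInterval, p.eval (x:ℝ) ∂ν := by
    have key : ∀ (ρ : Measure unitInterval) [IsFiniteMeasure ρ] (p : Polynomial ℝ),
        ∫ x : unitInterval, p.eval (x:ℝ) ∂ρ = ∑ k ∈ Finset.range (p.natDegree+1), p.coeff k * ∫ x, (x:ℝ)^k ∂ρ := by
      intro ρ _ p
      simp_rw [Polynomial.eval_eq_sum_range, ← integral_const_mul]
      rw [integral_finsetSum]
      intro k _
      exact hi ρ ⟨fun x => p.coeff k * (x:ℝ)^k, by fun_prop⟩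
    intro p
    simp_rw [key, h]
  apply ext_of_forall_integral_eq_of_IsFiniteMeasure
  intro f
  have hcl : IsClosed {f : C(unitInterval, ℝ) | ∫ x, f x ∂μ = ∫ x, f x ∂ν} :=
    isClosed_eq (hc μ) (hc ν)
  have hmem : f.toContinuousMap ∈ closure ((polynomialFunctions unitInterval : Set C(unitInterval, ℝ))) := by
    have := polynomialFunctions_closure_eq_top'
    rw [← Subalgebra.topologicalClosure_coe, this]
    trivial
  refine (closure_minimal ?_ hcl) hmem
  rintro _ ⟨p, -, rfl⟩
  exact hp p

def CMS (F : ℕ → ℝ → ℝ) : Prop :=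
  ∀ n v, 0 < v → 0 ≤ F n v ∧ HasDerivAt (F n) (-F (n+1) v) v

theorem CMS_of {g : ℝ → ℝ} (hg : CompletelyMonotoneOnPos g) :
    ∃ F, CMS F ∧ ∀ v, F 0 v = g v := by
  refine ⟨fun n v => (-1 : ℝ) ^ n * iteratedDerivWithin n g (Set.Ioi 0) v, ?_, by simp⟩
  intro n v hv
  refine ⟨hg.2 n v hv, ?_⟩
  have hd : DifferentiableOn ℝ (iteratedDerivWithin n g (Set.Ioi 0)) (Set.Ioi 0) :=
    hg.1.differentiableOn_iteratedDerivWithin (by exact_mod_cast WithTop.coe_lt_top _)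
      (uniqueDiffOn_Ioi 0)
  have h1 := (hd v hv).hasDerivWithinAt.hasDerivAt (Ioi_mem_nhds hv)
  rw [← iteratedDerivWithin_succ] at h1
  have := h1.const_mul ((-1 : ℝ) ^ n)
  have e : -((-1 : ℝ) ^ (n+1) * iteratedDerivWithin (n+1) g (Set.Ioi 0) v) =
      (-1 : ℝ) ^ n * iteratedDerivWithin (n+1) g (Set.Ioi 0) v := by ring
  show HasDerivAt _ (-((-1 : ℝ) ^ (n+1) * iteratedDerivWithin (n+1) g (Set.Ioi 0) v)) v
  rw [e]
  exact this

theorem CMS.anti {F} (hF : CMS F) (n : ℕ) : AntitoneOn (F n) (Set.Ioi 0) := by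
  refine antitoneOn_of_deriv_nonpos (convex_Ioi 0)
    (fun v hv => (hF n v hv).2.continuousAt.continuousWithinAt) ?_ ?_
  · intro v hv
    rw [interior_Ioi] at hv
    exact (hF n v hv).2.differentiableAt.differentiableWithinAt
  · intro v hv
    rw [interior_Ioi] at hv
    rw [(hF n v hv).2.deriv]
    linarith [(hF (n+1) v hv).1]

theorem CMS.diff {F} (hF : CMS F) {δ : ℝ} (hδ : 0 < δ) : CMS (fun n v => F n v - F n (v + δ)) := by
  intro n v hv
  have hv' : 0 < v + δ := by linarith
  refine ⟨?_, ?_⟩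
  · have := hF.anti n hv hv' (by linarith)
    simpa using this
  · have h1 := (hF n v hv).2
    have h2 := (hF n (v+δ) hv').2.comp_add_const v δ
    have h3 := h1.sub h2
    have e : -(F (n+1) v - F (n+1) (v + δ)) = -F (n+1) v - -F (n+1) (v+δ) := by ring
    show HasDerivAt _ (-(F (n+1) v - F (n+1) (v + δ))) v
    rw [e]
    exact h3

open Polynomial in
noncomputable def momL (c : ℕ → ℝ) : ℝ[X] →ₗ[ℝ] ℝ := (Polynomial.basisMonomials ℝ).constr ℝ c

open Polynomial in
theorem momL_X (c : ℕ → ℝ) (k : ℕ) : momL c (X ^ k) = c k := by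
  have := (Polynomial.basisMonomials ℝ).constr_basis ℝ c k
  rw [Polynomial.coe_basisMonomials] at this
  rw [← Polynomial.monomial_one_right_eq_X_pow]
  exact this

open Polynomial in
theorem momL_sub (c : ℕ → ℝ) (p : ℝ[X]) :
    momL c (p * (1 - X)) = momL (fun k => c k - c (k+1)) p := by
  have : (momL c) ∘ₗ (LinearMap.mulRight ℝ (1 - X : ℝ[X])) = momL (fun k => c k - c (k+1)) := by
    refine (Polynomial.basisMonomials ℝ).ext fun k => ?_
    simp only [Polynomial.coe_basisMonomials, LinearMap.comp_apply, LinearMap.mulRight_apply,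
      Polynomial.monomial_one_right_eq_X_pow, momL_X]
    rw [mul_sub, mul_one, ← pow_succ, map_sub, momL_X, momL_X]
  exact LinearMap.congr_fun this p

open Polynomial in
theorem CMS.momL_nonneg {a δ : ℝ} (ha : 0 < a) (hδ : 0 < δ) (k j : ℕ) : ∀ {F}, CMS F →
    0 ≤ momL (fun k => F 0 (a + k * δ)) (X ^ k * (1 - X) ^ j) := by
  induction j with
  | zero =>
    intro F hF
    rw [pow_zero, mul_one, momL_X]
    exact (hF 0 _ (by positivity)).1
  | succ j ih =>
    intro F hF
    rw [pow_succ, ← mul_assoc, momL_sub]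
    convert ih (hF.diff hδ) using 3
    ext i
    push_cast
    ring_nf

theorem CMS.exists_meas {F} (hF : CMS F) (hpos : ∀ v, 0 < v → 0 < F 0 v) {a δ : ℝ} (ha : 0 < a)
    (hδ : 0 < δ) : ∃ μ : Measure unitInterval, IsFiniteMeasure μ ∧
      ∀ m : ℕ, ∫ x, (x:ℝ)^m ∂μ = F 0 (a + m * δ) := by
  have hp := hpos a ha
  obtain ⟨P, hP⟩ := hausdorff ((F 0 a)⁻¹ • momL (fun k => F 0 (a + k * δ)))
    (fun k j => by
      rw [LinearMap.smul_apply, smul_eq_mul]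
      exact mul_nonneg (by positivity) (hF.momL_nonneg ha hδ k j))
    (by
      have := momL_X (fun k => F 0 (a + k * δ)) 0
      rw [pow_zero] at this
      rw [LinearMap.smul_apply, this, smul_eq_mul]
      simp [hp.ne'])
  refine ⟨ENNReal.ofReal (F 0 a) • (P : Measure unitInterval), ?_, fun m => ?_⟩
  · exact Measure.smul_finite _ ENNReal.ofReal_ne_top
  · rw [integral_smul_measure, hP, ENNReal.toReal_ofReal hp.le, LinearMap.smul_apply, momL_X]
    simp only [smul_eq_mul]
    field_simp

theorem intble_rpow (μ : Measure unitInterval) [IsFiniteMeasure μ] {r : ℝ} (hr : 0 ≤ r) :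
    Integrable (fun x : unitInterval => (x:ℝ)^r) μ := by
  refine Integrable.of_bound (C := 1) ?_ ?_
  · exact (by fun_prop : Measurable (fun x : unitInterval => (x:ℝ)^r)).aestronglyMeasurable
  · refine Eventually.of_forall fun x => ?_
    rw [Real.norm_of_nonneg (Real.rpow_nonneg x.2.1 _)]
    exact Real.rpow_le_one x.2.1 x.2.2 hr

theorem CMS.exists_meas_real {F} (hF : CMS F) (hpos : ∀ v, 0 < v → 0 < F 0 v) {a : ℝ} (ha : 0 < a) :
    ∃ μ : Measure unitInterval, IsFiniteMeasure μ ∧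
      ∀ r : ℝ, 0 ≤ r → ∫ x, (x:ℝ)^r ∂μ = F 0 (a + r) := by
  obtain ⟨μ, hμ, hm⟩ := hF.exists_meas hpos ha one_pos
  refine ⟨μ, hμ, ?_⟩
  have hrat : ∀ (k N : ℕ), 0 < N → ∫ x, (x:ℝ)^((k:ℝ)/N) ∂μ = F 0 (a + (k:ℝ)/N) := by
    intro k N hN
    have hN' : (0:ℝ) < N := by exact_mod_cast hN
    obtain ⟨ν, hν, hn⟩ := hF.exists_meas hpos ha (inv_pos.2 hN')
    have hmeas : Measurable (fun x : unitInterval => x ^ N) := by fun_prop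
    have e : ν.map (fun x : unitInterval => x ^ N) = μ := by
      apply meas_uniq
      intro m
      rw [integral_map hmeas.aemeasurable
        (by exact (by fun_prop : Measurable (fun x : unitInterval => (x:ℝ)^m)).aestronglyMeasurable), hm]
      have := hn (N * m)
      simp only [Set.Icc.coe_pow, ← pow_mul]
      rw [this]
      congr 1
      push_cast
      field_simp
    rw [← e, integral_map hmeas.aemeasurable
        (by exact (by fun_prop : Measurable (fun x : unitInterval => (x:ℝ)^((k:ℝ)/N))).aestronglyMeasurable)]
    have := hn k
    rw [← div_eq_mul_inv] at this
    rw [← this]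
    refine integral_congr_ae (Eventually.of_forall fun x => ?_)
    simp only [Set.Icc.coe_pow]
    rw [← Real.rpow_natCast, ← Real.rpow_mul x.2.1, ← Real.rpow_natCast]
    congr 1
    field_simp
  have hEq : Set.EqOn (fun r : ℝ => ∫ x, (x:ℝ)^r ∂μ) (fun r => F 0 (a + r)) (Set.Ioi 0) := by
    refine Set.EqOn.of_subset_closure (s := Set.Ioi 0 ∩ Set.range ((↑) : ℚ → ℝ)) ?_ ?_ ?_
      Set.inter_subset_left ?_
    · rintro _ ⟨hq, ⟨q, rfl⟩⟩
      have hq' : 0 < q := by simpa using hq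
      have := hrat q.num.toNat q.den q.den_pos
      have e : ((q.num.toNat : ℕ) : ℝ) / (q.den : ℝ) = (q : ℝ) := by
        have h0 : ((q.num.toNat : ℕ) : ℤ) = q.num := Int.toNat_of_nonneg (Rat.num_pos.2 hq').le
        have h1 : ((q.num.toNat : ℕ) : ℝ) = (q.num : ℝ) := by exact_mod_cast congrArg (Int.cast (R := ℝ)) h0
        rw [h1]
        exact (Rat.cast_def q).symm
      rw [e] at this
      exact this
    · intro r hr
      refine ContinuousAt.continuousWithinAt ?_
      refine continuousAt_of_dominated (bound := fun _ => 1) ?_ ?_ (integrable_const _) ?_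
      · exact Eventually.of_forall fun r =>
          (by fun_prop : Measurable (fun x : unitInterval => (x:ℝ)^r)).aestronglyMeasurable
      · filter_upwards [Ioi_mem_nhds hr] with s hs
        refine Eventually.of_forall fun x => ?_
        rw [Real.norm_of_nonneg (Real.rpow_nonneg x.2.1 _)]
        exact Real.rpow_le_one x.2.1 x.2.2 (le_of_lt hs)
      · exact Eventually.of_forall fun x => Real.continuousAt_const_rpow' (ne_of_gt hr)
    · intro r hr
      have hr' : 0 < a + r := by
        have : 0 < r := hr
        linarith
      have := (hF 0 (a+r) hr').2.continuousAt
      exact (ContinuousAt.comp (f := fun r => a + r) this (by fun_prop)).continuousWithinAt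
    · exact Rat.denseRange_cast.open_subset_closure_inter isOpen_Ioi
  intro r hr
  rcases hr.eq_or_lt with h | h
  · subst h
    have := hm 0
    simpa using this
  · exact hEq h

theorem CMS.bernstein {F} (hF : CMS F) (hpos : ∀ v, 0 < v → 0 < F 0 v)
    (hlim : ∀ a, 0 < a → ∀ ε > 0, ∃ k : ℕ, F 0 (a + k) < ε) :
    ∃ μ : Measure unitInterval, ∀ v, 0 < v →
      ∫⁻ x in Set.Ioo 0 1, ENNReal.ofReal ((x:ℝ)^(v-1)) ∂μ = ENNReal.ofReal (F 0 v) := by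
  obtain ⟨μ, hμ, hm⟩ := hF.exists_meas_real hpos one_pos
  refine ⟨μ, fun v hv => ?_⟩
  obtain ⟨a, ha, hav, ha1⟩ : ∃ a : ℝ, 0 < a ∧ a < v ∧ a < 1 :=
    ⟨min v 1 / 2, by positivity, by have := min_le_left v 1; linarith, by have := min_le_right v 1; linarith⟩
  obtain ⟨ν, hν, hn⟩ := hF.exists_meas_real hpos ha
  have hmr : ∀ r : ℝ, Measurable (fun x : unitInterval => ENNReal.ofReal ((x:ℝ)^r)) := fun r => by fun_prop
  have hfin : IsFiniteMeasure (ν.withDensity (fun x => ENNReal.ofReal ((x:ℝ)^(1-a)))) :=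
    isFiniteMeasure_withDensity_ofReal (intble_rpow ν (by linarith)).2
  have e : μ = ν.withDensity (fun x => ENNReal.ofReal ((x:ℝ)^(1-a))) := by
    apply meas_uniq
    intro m
    have h1 := hm m (by positivity)
    simp only [Real.rpow_natCast] at h1
    rw [h1, integral_withDensity_eq_integral_toReal_smul (hmr _)
      (Eventually.of_forall fun x => ENNReal.ofReal_lt_top)]
    have h2 := hn (m + (1 - a)) (by have : (0:ℝ) ≤ m := by positivity
                                    linarith)
    rw [show 1 + (m:ℝ) = a + (m + (1 - a)) by ring, ← h2]
    refine integral_congr_ae (Eventually.of_forall fun x => ?_)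
    simp only [smul_eq_mul]
    rw [ENNReal.toReal_ofReal (Real.rpow_nonneg x.2.1 _),
      Real.rpow_add_of_nonneg x.2.1 (by positivity) (by linarith), Real.rpow_natCast, mul_comm]
  have hν1 : ν {1} = 0 := by
    by_contra hne
    have hp : 0 < ν.real {1} := by
      rw [measureReal_def]
      exact ENNReal.toReal_pos hne (measure_ne_top _ _)
    obtain ⟨k, hk⟩ := hlim a ha _ hp
    have h1 := hn k (by positivity)
    have h2 : ∫ x, Set.indicator {(1:unitInterval)} (fun _ => (1:ℝ)) x ∂ν ≤ ∫ x, (x:ℝ)^(k:ℝ) ∂ν := by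
      refine integral_mono ((integrable_const _).indicator (measurableSet_singleton _))
        (intble_rpow ν (by positivity)) fun x => ?_
      by_cases hx : x = 1
      · subst hx; simp
      · simp [hx, x.2.1]
    rw [integral_indicator (measurableSet_singleton _), h1] at h2
    simp at h2
    rw [measureReal_def] at hk
    linarith
  rw [e, restrict_withDensity measurableSet_Ioo,
    lintegral_withDensity_eq_lintegral_mul _ (hmr _) (hmr _)]
  have e2 : ∫⁻ x in Set.Ioo (0:unitInterval) 1, ((fun x : unitInterval => ENNReal.ofReal ((x:ℝ)^(1-a))) *
      (fun x : unitInterval => ENNReal.ofReal ((x:ℝ)^(v-1)))) x ∂ν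
      = ∫⁻ x in Set.Ioo (0:unitInterval) 1, ENNReal.ofReal ((x:ℝ)^(v-a)) ∂ν := by
    refine setLIntegral_congr_fun measurableSet_Ioo fun x hx => ?_
    have hx0 : (0:ℝ) < x := hx.1
    simp only [Pi.mul_apply]
    rw [← ENNReal.ofReal_mul (Real.rpow_nonneg x.2.1 _), ← Real.rpow_add hx0]
    congr 2
    ring
  rw [e2]
  have h3 := hn (v-a) (by linarith)
  rw [show a + (v-a) = v by ring] at h3
  rw [← h3, ofReal_integral_eq_lintegral_ofReal (intble_rpow ν (by linarith))
    (Eventually.of_forall fun x => Real.rpow_nonneg x.2.1 _), ← lintegral_indicator measurableSet_Ioo]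
  refine lintegral_congr_ae ?_
  have : ∀ᵐ x ∂ν, x ≠ 1 := by
    rw [ae_iff]; simpa using hν1
  filter_upwards [this] with x hx
  by_cases hx0 : x = 0
  · subst hx0
    simp [Real.zero_rpow (show v - a ≠ 0 by linarith)]
  · rw [Set.indicator_of_mem]
    exact ⟨lt_of_le_of_ne x.2.1 (fun h => hx0 h.symm), lt_of_le_of_ne x.2.2 hx⟩

theorem lim_zero {F} (hF : CMS F)
    (hfin : (∫⁻ v in Set.Ioi (0 : ℝ), ENNReal.ofReal (F 0 v * min 1 (v ^ 2))) < ⊤) :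
    ∀ a, 0 < a → ∀ ε > 0, ∃ k : ℕ, F 0 (a + k) < ε := by
  intro a ha ε hε
  by_contra! hcon
  have hge : ∀ v, 0 < v → ε ≤ F 0 v := by
    intro v hv
    obtain ⟨k, hk⟩ := exists_nat_ge v
    exact (hcon k).trans (hF.anti 0 hv (show (0:ℝ) < a + k by positivity) (by linarith))
  have h1 : (∫⁻ v in Set.Ioi (1 : ℝ), ENNReal.ofReal ε) ≤
      ∫⁻ v in Set.Ioi (0 : ℝ), ENNReal.ofReal (F 0 v * min 1 (v ^ 2)) := by
    refine le_trans (setLIntegral_mono' measurableSet_Ioi fun v hv => ?_)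
      (lintegral_mono_set (Set.Ioi_subset_Ioi zero_le_one))
    have hv1 : (1:ℝ) < v := hv
    rw [min_eq_left (by nlinarith), mul_one]
    exact ENNReal.ofReal_le_ofReal (hge v (by linarith))
  rw [setLIntegral_const, Real.volume_Ioi, ENNReal.mul_top (by simpa using hε)] at h1
  exact absurd (top_le_iff.1 h1) hfin.ne

theorem backward (h : ℝ → ℝ) (g : ℝ → ℝ) (hg : CompletelyMonotoneOnPos g)
    (hgpos : ∀ v ∈ Set.Ioi (0 : ℝ), 0 < g v)
    (hh : ∀ y ∈ Set.Ioo (0 : ℝ) 1, h y = (y / (1 - y)) ^ 2 * g (y / (1 - y)))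
    (hfin : (∫⁻ v in Set.Ioi (0 : ℝ), ENNReal.ofReal (g v * min 1 (v ^ 2))) < ⊤) :
    ∃ η : Measure ℝ, η (Set.Ioi (0 : ℝ))ᶜ = 0 ∧
      ∀ y ∈ Set.Ioo (0 : ℝ) 1,
        ENNReal.ofReal (h y) =
          ∫⁻ κ, ENNReal.ofReal (κ⁻¹ * (y / (1 - y)) ^ 2 *
            Real.exp (-(y / (κ * (1 - y))))) ∂η := by
  obtain ⟨F, hF, hF0⟩ := CMS_of hg
  have hF0' : F 0 = g := funext hF0
  obtain ⟨μ, hμ⟩ := hF.bernstein (fun v hv => hF0 v ▸ hgpos v hv)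
    (lim_zero hF (by rw [hF0']; exact hfin))
  have hκ : Measurable (fun x : unitInterval => (-Real.log (x:ℝ))⁻¹) := by fun_prop
  have hd : Measurable (fun x : unitInterval => ENNReal.ofReal ((x:ℝ)⁻¹ * (-Real.log (x:ℝ))⁻¹)) := by
    fun_prop
  have hlog : ∀ x ∈ Set.Ioo (0:unitInterval) 1, 0 < -Real.log (x:ℝ) := by
    intro x hx
    have := Real.log_neg (show (0:ℝ) < x from hx.1) (show (x:ℝ) < 1 from hx.2)
    linarith
  refine ⟨((μ.restrict (Set.Ioo 0 1)).withDensity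
    (fun x => ENNReal.ofReal ((x:ℝ)⁻¹ * (-Real.log (x:ℝ))⁻¹))).map
    (fun x : unitInterval => (-Real.log (x:ℝ))⁻¹), ?_, ?_⟩
  · rw [Measure.map_apply hκ measurableSet_Ioi.compl]
    refine withDensity_absolutelyContinuous _ _ ?_
    rw [Measure.restrict_apply (hκ measurableSet_Ioi.compl)]
    convert measure_empty (μ := μ)
    ext x
    simp only [Set.mem_inter_iff, Set.mem_preimage, Set.mem_compl_iff, Set.mem_Ioi,
      Set.mem_empty_iff_false, iff_false, not_and]
    intro h1 h2
    exact h1 (inv_pos.2 (hlog x h2))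
  · intro y hy
    have hy1 : 0 < 1 - y := by linarith [hy.2]
    have hv : 0 < y / (1 - y) := div_pos hy.1 hy1
    rw [lintegral_map (by fun_prop) hκ,
      lintegral_withDensity_eq_lintegral_mul _ hd (by fun_prop), hh y hy,
      ENNReal.ofReal_mul (by positivity), ← hF0, ← hμ _ hv,
      ← lintegral_const_mul _ (by fun_prop)]
    refine setLIntegral_congr_fun measurableSet_Ioo fun x hx => ?_
    have hx0 : (0:ℝ) < x := hx.1
    have hl := hlog x hx
    simp only [Pi.mul_apply]
    rw [← ENNReal.ofReal_mul (by positivity), ← ENNReal.ofReal_mul (by positivity)]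
    congr 1
    have e1 : Real.exp (-(y / ((-Real.log (x:ℝ))⁻¹ * (1 - y)))) = (x:ℝ)^(y/(1-y)) := by
      rw [Real.rpow_def_of_pos hx0]
      congr 1
      field_simp
    rw [e1, Real.rpow_sub_one hx0.ne']
    have hl0 : Real.log (x:ℝ) ≠ 0 := by
      intro h0
      rw [h0] at hl
      simp at hl
    field_simp

theorem forward (h : ℝ → ℝ)
    (hpos : ∀ y ∈ Set.Ioo (0 : ℝ) 1, 0 < h y)
    (hint : IntegrableOn h (Set.Ioo (0 : ℝ) 1)) (η : Measure ℝ) (hη : η (Set.Ioi (0 : ℝ))ᶜ = 0)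
    (hrep : ∀ y ∈ Set.Ioo (0 : ℝ) 1,
        ENNReal.ofReal (h y) =
          ∫⁻ κ, ENNReal.ofReal (κ⁻¹ * (y / (1 - y)) ^ 2 *
            Real.exp (-(y / (κ * (1 - y))))) ∂η) :
    (∃ g : ℝ → ℝ, CompletelyMonotoneOnPos g ∧
      (∀ v ∈ Set.Ioi (0 : ℝ), 0 < g v) ∧
      (∀ y ∈ Set.Ioo (0 : ℝ) 1, h y = (y / (1 - y)) ^ 2 * g (y / (1 - y))) ∧
      (∫⁻ v in Set.Ioi (0 : ℝ), ENNReal.ofReal (g v * min 1 (v ^ 2))) < ⊤) := by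
  set μ : Measure ℝ := η.withDensity (fun κ => ENNReal.ofReal κ⁻¹) with hμ
  set X : ℝ → ℝ := fun κ => -κ⁻¹ with hX
  have hae : ∀ᵐ κ ∂η, 0 < κ := by rw [ae_iff]; exact hη
  have haeμ : ∀ᵐ κ ∂μ, 0 < κ := (withDensity_absolutelyContinuous _ _).ae_le hae
  have hlin : ∀ v, 0 < v → ENNReal.ofReal (h (v / (1+v))) =
      ENNReal.ofReal (v^2) * ∫⁻ κ, ENNReal.ofReal (Real.exp (v * X κ)) ∂μ := by
    intro v hv
    have h1v : 0 < 1 + v := by linarith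
    have hy : v / (1+v) ∈ Set.Ioo (0:ℝ) 1 := ⟨by positivity, by rw [div_lt_one h1v]; linarith⟩
    have e1 : 1 - v/(1+v) = 1/(1+v) := by field_simp; ring
    rw [hrep _ hy, hμ, lintegral_withDensity_eq_lintegral_mul _ (by fun_prop) (by fun_prop),
      ← lintegral_const_mul _ (by fun_prop)]
    refine lintegral_congr_ae ?_
    filter_upwards [hae] with κ hκ
    simp only [Pi.mul_apply, e1]
    rw [← ENNReal.ofReal_mul (by positivity), ← ENNReal.ofReal_mul (by positivity)]
    congr 1
    have e2 : v / (1+v) / (1/(1+v)) = v := by field_simp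
    have e3 : -(v / (1+v) / (κ * (1/(1+v)))) = v * X κ := by simp only [hX]; field_simp
    rw [e2, e3]
    ring
  have hI : ∀ v, 0 < v → Integrable (fun κ => Real.exp (v * X κ)) μ := by
    intro v hv
    refine ⟨by fun_prop, ?_⟩
    rw [hasFiniteIntegral_iff_ofReal (Eventually.of_forall fun _ => (Real.exp_pos _).le)]
    by_contra hcon
    rw [not_lt, top_le_iff] at hcon
    have := hlin v hv
    rw [hcon, ENNReal.mul_top (by simpa using hv.ne')] at this
    exact ENNReal.ofReal_ne_top this
  have hmgf : ∀ v, 0 < v → h (v/(1+v)) = v^2 * ProbabilityTheory.mgf X μ v := by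
    intro v hv
    have h1v : 0 < 1 + v := by linarith
    have hy : v / (1+v) ∈ Set.Ioo (0:ℝ) 1 := ⟨by positivity, by rw [div_lt_one h1v]; linarith⟩
    have := hlin v hv
    rw [← ofReal_integral_eq_lintegral_ofReal (hI v hv)
      (Eventually.of_forall fun _ => (Real.exp_pos _).le), ← ENNReal.ofReal_mul (by positivity)] at this
    rw [ENNReal.ofReal_eq_ofReal_iff (hpos _ hy).le
      (mul_nonneg (by positivity) (integral_nonneg fun _ => (Real.exp_pos _).le))] at this
    exact this
  have hsub : Set.Ioi (0:ℝ) ⊆ interior (ProbabilityTheory.integrableExpSet X μ) :=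
    interior_maximal (fun v hv => hI v hv) isOpen_Ioi
  refine ⟨ProbabilityTheory.mgf X μ, ⟨?_, ?_⟩, ?_, ?_, ?_⟩
  · exact ((ProbabilityTheory.analyticOnNhd_mgf.mono hsub).analyticOn).contDiffOn (uniqueDiffOn_Ioi 0)
  · intro n v hv
    rw [iteratedDerivWithin_of_isOpen isOpen_Ioi hv, ProbabilityTheory.iteratedDeriv_mgf (hsub hv),
      ← integral_const_mul]
    refine integral_nonneg_of_ae ?_
    filter_upwards [haeμ] with κ hκ
    simp only [hX, Pi.zero_apply]
    rw [← mul_assoc, ← mul_pow]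
    have : (-1:ℝ) * -κ⁻¹ = κ⁻¹ := by ring
    rw [this]
    positivity
  · intro v hv
    have hv' : 0 < v := hv
    have h1v : 0 < 1 + v := by linarith
    have hy : v / (1+v) ∈ Set.Ioo (0:ℝ) 1 := ⟨by positivity, by rw [div_lt_one h1v]; linarith⟩
    have := hpos _ hy
    rw [hmgf v hv'] at this
    exact pos_of_mul_pos_right this (by positivity)
  · intro y hy
    have hy1 : 0 < 1 - y := by linarith [hy.2]
    have hv : 0 < y / (1 - y) := div_pos hy.1 hy1
    rw [← hmgf _ hv]
    congr 1
    field_simp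
    ring
  · have himg : (fun v : ℝ => v / (1+v)) '' Set.Ioi 0 = Set.Ioo 0 1 := by
      ext y
      constructor
      · rintro ⟨v, hv, rfl⟩
        have hv' : 0 < v := hv
        have h1v : 0 < 1 + v := by linarith
        exact ⟨by positivity, by simp only; rw [div_lt_one h1v]; linarith⟩
      · intro hy
        have hy1 : 0 < 1 - y := by linarith [hy.2]
        refine ⟨y / (1-y), div_pos hy.1 hy1, ?_⟩
        simp only
        field_simp
        ring
    have hder : ∀ v ∈ Set.Ioi (0:ℝ), HasDerivWithinAt (fun v : ℝ => v / (1+v)) (1/(1+v)^2) (Set.Ioi 0) v := by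
      intro v hv
      have hv' : 0 < v := hv
      have h1v : 1 + v ≠ 0 := by linarith
      have := (hasDerivAt_id v).div ((hasDerivAt_id v).const_add 1) h1v
      refine HasDerivAt.hasDerivWithinAt ?_
      have e : (1/(1+v)^2 : ℝ) = (1 * (1 + id v) - id v * 1) / (1 + id v)^2 := by simp
      rw [e]
      exact this
    have hinj : Set.InjOn (fun v : ℝ => v / (1+v)) (Set.Ioi 0) := by
      intro v hv w hw hvw
      have hv' : 0 < v := hv
      have hw' : 0 < w := hw
      replace hvw : v / (1+v) = w / (1+w) := hvw
      rw [div_eq_div_iff (by linarith) (by linarith)] at hvw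
      linarith
    have hcv := lintegral_image_eq_lintegral_abs_deriv_mul measurableSet_Ioi hder hinj
      (fun y => ENNReal.ofReal (h y))
    rw [himg] at hcv
    have hfin : ∫⁻ y in Set.Ioo (0:ℝ) 1, ENNReal.ofReal (h y) < ⊤ := by
      have := hint.2
      rwa [hasFiniteIntegral_iff_ofReal] at this
      filter_upwards [ae_restrict_mem measurableSet_Ioo] with y hy
      exact (hpos y hy).le
    rw [hcv] at hfin
    refine lt_of_le_of_lt ?_ (ENNReal.mul_lt_top (ENNReal.ofReal_lt_top (r := 4)) hfin)
    rw [← lintegral_const_mul' _ _ ENNReal.ofReal_ne_top]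
    refine setLIntegral_mono' measurableSet_Ioi fun v hv => ?_
    have hv' : 0 < v := hv
    have hm : 0 ≤ ProbabilityTheory.mgf X μ v := ProbabilityTheory.mgf_nonneg
    rw [hmgf v hv', ← ENNReal.ofReal_mul (abs_nonneg _), ← ENNReal.ofReal_mul (by norm_num)]
    refine ENNReal.ofReal_le_ofReal ?_
    rw [abs_of_pos (by positivity)]
    have hle : min 1 (v^2) ≤ 4 * (1/(1+v)^2 * v^2) := by
      rw [show 4 * (1/(1+v)^2 * v^2) = (4 * v^2) / (1+v)^2 by ring, le_div_iff₀ (by positivity)]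
      rcases le_total v 1 with h1 | h1
      · rw [min_eq_right (by nlinarith)]
        have : (1+v)^2 ≤ 4 := by nlinarith
        nlinarith [sq_nonneg v]
      · rw [min_eq_left (by nlinarith)]
        nlinarith
    calc _ ≤ ProbabilityTheory.mgf X μ v * (4 * (1/(1+v)^2 * v^2)) := mul_le_mul_of_nonneg_left hle hm
      _ = _ := by ring

/-- An integrable function `h : (0,1) → (0,∞)` can be expressed as
`h(y) = ∫₀^∞ (1/κ)(y/(1−y))² exp(−y/(κ(1−y))) η(dκ)` for some measure `η` on `(0,∞)`
if and only if there is a completely monotone `g : (0,∞) → (0,∞)` with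
`h(y) = (y/(1−y))² g(y/(1−y))` for all `y ∈ (0,1)` and `∫₀^∞ g(v)(1 ∧ v²) dv < ∞`. -/
theorem stmt_16 (h : ℝ → ℝ)
    (hpos : ∀ y ∈ Set.Ioo (0 : ℝ) 1, 0 < h y)
    (hint : IntegrableOn h (Set.Ioo (0 : ℝ) 1)) :
    (∃ η : Measure ℝ, η (Set.Ioi (0 : ℝ))ᶜ = 0 ∧
      ∀ y ∈ Set.Ioo (0 : ℝ) 1,
        ENNReal.ofReal (h y) =
          ∫⁻ κ, ENNReal.ofReal (κ⁻¹ * (y / (1 - y)) ^ 2 *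
            Real.exp (-(y / (κ * (1 - y))))) ∂η) ↔
    (∃ g : ℝ → ℝ, CompletelyMonotoneOnPos g ∧
      (∀ v ∈ Set.Ioi (0 : ℝ), 0 < g v) ∧
      (∀ y ∈ Set.Ioo (0 : ℝ) 1, h y = (y / (1 - y)) ^ 2 * g (y / (1 - y))) ∧
      (∫⁻ v in Set.Ioi (0 : ℝ), ENNReal.ofReal (g v * min 1 (v ^ 2))) < ⊤) := by
  constructor
  · rintro ⟨η, hη, hrep⟩
    exact forward h hpos hint η hη hrep
  · rintro ⟨g, hg, hgpos, hh, hfin⟩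
    exact backward h g hg hgpos hh hfin
end
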